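/- Suppose Π is a nonempty compact topological space and f : Π → ℝ^m is continuous (so Π_P is nonempty). Then for every π ∈ Π the Pareto suboptimality gap satisfies PSG(π) = sup_{π* ∈ Π_P} inf_{λ ∈ Δ_m} Σ_{i=1}^m λ_i ( f_i(π*) − f_i(π) ) = sup_{π* ∈ Π_P} min_{1 ≤ i ≤ m} ( f_i(π*) − f_i(π) ). -/

import Mathlib

/-- `π'` dominates `π`: it is at least as good on every objective and strictly
better on at least one objective. -/
def Dominates {Pol : Type*} {m : ℕ} (f : Pol → Fin m → ℝ) (π' π : Pol) : Prop :=
  (∀ i, f π i ≤ f π' i) ∧ ∃ j, f π j < f π' j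

/-- A policy is Pareto optimal iff no policy dominates it. -/
def ParetoOptimal {Pol : Type*} {m : ℕ} (f : Pol → Fin m → ℝ) (π : Pol) : Prop :=
  ¬ ∃ π' : Pol, Dominates f π' π

/-- The Pareto suboptimality gap of a policy `π`: the infimum of `ε ≥ 0` such that
for every Pareto optimal policy `π*`, either some objective of `π` shifted by `ε`
strictly exceeds the corresponding objective of `π*`, or all objectives of `π`
shifted by `ε` equal those of `π*`. -/
noncomputable def PSG {Pol : Type*} {m : ℕ} (f : Pol → Fin m → ℝ) (π : Pol) : ℝ :=
  sInf {ε : ℝ | 0 ≤ ε ∧ ∀ πs : Pol, ParetoOptimal f πs →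
    ((∃ i, f πs i < f π i + ε) ∨ (∀ i, f π i + ε = f πs i))}

lemma exists_pareto_ge {Pol : Type*} [TopologicalSpace Pol] [CompactSpace Pol]
    {m : ℕ} (f : Pol → Fin m → ℝ) (hf : Continuous f) (π : Pol) :
    ∃ πs, ParetoOptimal f πs ∧ ∀ i, f π i ≤ f πs i := by
  have hfi : ∀ i, Continuous fun p => f p i := fun i => (continuous_apply i).comp hf
  have hc : IsCompact {p : Pol | ∀ i, f π i ≤ f p i} := by
    apply IsClosed.isCompact
    rw [Set.ofPred_forall]
    exact isClosed_iInter fun i => isClosed_le continuous_const (hfi i)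
  have hs : Continuous fun p => ∑ i, f p i := continuous_finsetSum _ fun i _ => hfi i
  obtain ⟨q, hq, hmax⟩ := hc.exists_isMaxOn ⟨π, fun i => le_rfl⟩ hs.continuousOn
  refine ⟨q, ?_, hq⟩
  rintro ⟨p, hp, j, hj⟩
  have h1 : ∑ i, f p i ≤ ∑ i, f q i := hmax (fun i => (hq i).trans (hp i))
  have h2 : ∑ i, f q i < ∑ i, f p i :=
    Finset.sum_lt_sum (fun i _ => hp i) ⟨j, Finset.mem_univ _, hj⟩
  linarith

lemma sInf_simplex {m : ℕ} (hm : 1 ≤ m) (g : Fin m → ℝ) :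
    sInf ((fun lam => ∑ i, lam i * g i) '' stdSimplex ℝ (Fin m)) = sInf (Set.range g) := by
  have : Nonempty (Fin m) := ⟨⟨0, hm⟩⟩
  have hb : BddBelow (Set.range g) := (Set.finite_range g).bddBelow
  have key : ∀ x ∈ ((fun lam => ∑ i, lam i * g i) '' stdSimplex ℝ (Fin m)),
      sInf (Set.range g) ≤ x := by
    rintro _ ⟨l, ⟨h0, h1⟩, rfl⟩
    calc sInf (Set.range g) = ∑ i, l i * sInf (Set.range g) := by
          rw [← Finset.sum_mul, h1, one_mul]
      _ ≤ _ := Finset.sum_le_sum fun i _ =>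
          mul_le_mul_of_nonneg_left (csInf_le hb ⟨i, rfl⟩) (h0 i)
  have hsub : Set.range g ⊆ ((fun lam => ∑ i, lam i * g i) '' stdSimplex ℝ (Fin m)) := by
    rintro _ ⟨i, rfl⟩
    exact ⟨Pi.single i 1, single_mem_stdSimplex ℝ i, by simp [Pi.single_apply]⟩
  apply le_antisymm
  · exact csInf_le_csInf ⟨_, key⟩ (Set.range_nonempty g) hsub
  · exact le_csInf ((Set.range_nonempty g).mono hsub) key

/-- Equivalent sup-inf form of the Pareto suboptimality gap: it equals the supremum
over Pareto optimal policies `π*` of the infimum over simplex weights `λ` of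
`∑ i, λ i * (f i (π*) − f i (π))`, which is also the supremum over `π*` of the
minimum coordinate of `f (π*) − f (π)`. -/
theorem psg_eq_sup_inf
    {Pol : Type*} [TopologicalSpace Pol] [CompactSpace Pol] [Nonempty Pol]
    {m : ℕ} (hm : 1 ≤ m) (f : Pol → Fin m → ℝ) (hf : Continuous f) (π : Pol) :
    PSG f π =
      sSup ((fun πs => sInf ((fun lam => ∑ i, lam i * (f πs i - f π i)) ''
          stdSimplex ℝ (Fin m))) '' {πs : Pol | ParetoOptimal f πs}) ∧
    PSG f π =
      sSup ((fun πs => sInf (Set.range fun i => f πs i - f π i)) ''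
          {πs : Pol | ParetoOptimal f πs}) := by
  have : Nonempty (Fin m) := ⟨⟨0, hm⟩⟩
  simp only [sInf_simplex hm, and_self]
  have hb : ∀ p, BddBelow (Set.range fun i => f p i - f π i) :=
    fun p => (Set.finite_range _).bddBelow
  obtain ⟨q, hq, hqge⟩ := exists_pareto_ge f hf π
  have hbdd : BddAbove ((fun πs => sInf (Set.range fun i => f πs i - f π i)) ''
          {πs : Pol | ParetoOptimal f πs}) := by
    have hc : Continuous fun p => f p ⟨0, hm⟩ := (continuous_apply _).comp hf
    obtain ⟨B, hB⟩ := (isCompact_range hc).bddAbove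
    refine ⟨B - f π ⟨0, hm⟩, ?_⟩
    rintro _ ⟨p, _, rfl⟩
    exact (csInf_le (hb p) ⟨⟨0, hm⟩, rfl⟩).trans (sub_le_sub_right (hB ⟨p, rfl⟩) _)
  have hS0 : 0 ≤ sSup ((fun πs => sInf (Set.range fun i => f πs i - f π i)) ''
          {πs : Pol | ParetoOptimal f πs}) := by
    refine le_trans ?_ (le_csSup hbdd ⟨q, hq, rfl⟩)
    apply le_csInf (Set.range_nonempty _)
    rintro _ ⟨i, rfl⟩
    exact sub_nonneg.2 (hqge i)
  have hmem : ∀ ε, sSup ((fun πs => sInf (Set.range fun i => f πs i - f π i)) ''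
          {πs : Pol | ParetoOptimal f πs}) < ε → ε ∈ {ε : ℝ | 0 ≤ ε ∧
      ∀ πs : Pol, ParetoOptimal f πs →
      ((∃ i, f πs i < f π i + ε) ∨ (∀ i, f π i + ε = f πs i))} := by
    intro ε hε
    refine ⟨hS0.trans hε.le, fun p hp => Or.inl ?_⟩
    have h1 := (le_csSup hbdd ⟨p, hp, rfl⟩).trans_lt hε
    obtain ⟨_, ⟨i, rfl⟩, hi⟩ := exists_lt_of_csInf_lt (Set.range_nonempty _) h1
    exact ⟨i, by simp only at hi; linarith⟩
  unfold PSG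
  apply le_antisymm
  · apply le_of_forall_gt_imp_ge_of_dense
    intro ε hε
    exact csInf_le ⟨0, fun x hx => hx.1⟩ (hmem ε hε)
  · refine le_csInf ⟨_, hmem _ (lt_add_one _)⟩ ?_
    rintro ε ⟨_, h⟩
    refine csSup_le (Set.Nonempty.image _ ⟨q, hq⟩) ?_
    rintro _ ⟨p, hp, rfl⟩
    rcases h p hp with ⟨i, hi⟩ | h
    · exact (csInf_le (hb p) ⟨i, rfl⟩).trans (by simp only; linarith)
    · refine (csInf_le (hb p) ⟨⟨0, hm⟩, rfl⟩).trans ?_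
      have := h ⟨0, hm⟩
      simp only; linarith
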